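/- arXiv:1908.06864 — 2 statements merged into one kernel-verified Lean document; each statement's English description precedes it below -/
import Mathlib

section
/- Let k be a positive natural number. Define the matrix A over the field ZMod 2 with rows indexed by ZMod k and columns indexed by the nonzero elements of ZMod k, whose (i, j) entry is (if j = i then 1 else 0) + (if j = i − 2 then 1 else 0), the sum taken in ZMod 2. Then the rank of A equals k − 2 if k is even, and equals k − 1 if k is odd. (This is the matrix-rank computation underlying Proposition 4: for a knot diagram K on the torus T^2 with homotopy class p[m] + q[l] and k = gcd(p, q) > 0, the incidence matrix of a minimal diagram in this class, with respect to the modified region crossing change, is the matrix A, and consequently rank_{Z_2}(M_K) = r − 2 if k is even and r − 1 if k is odd, where r is the number of regions.) -/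
/-- Extension by zero. -/
def extZ {k : ℕ} (v : {j : ZMod k // j ≠ 0} → ZMod 2) (x : ZMod k) : ZMod 2 :=
  if h : x ≠ 0 then v ⟨x, h⟩ else 0

lemma extZ_sum {k : ℕ} [NeZero k] (v : {j : ZMod k // j ≠ 0} → ZMod 2) (x : ZMod k) :
    ∑ j : {j : ZMod k // j ≠ 0}, (if (j : ZMod k) = x then (1 : ZMod 2) else 0) * v j
      = extZ v x := by
  unfold extZ
  split_ifs with h
  · rw [Finset.sum_eq_single ⟨x, h⟩]
    · simp
    · intro b _ hb
      have : (b : ZMod k) ≠ x := fun e => hb (Subtype.ext e)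
      simp [this]
    · simp
  · apply Finset.sum_eq_zero
    intro j _
    have : (j : ZMod k) ≠ x := fun e => h (e ▸ j.2)
    simp [this]

lemma extZ_even {k : ℕ} (v : {j : ZMod k // j ≠ 0} → ZMod 2)
    (h : ∀ i, extZ v i = extZ v (i - 2)) (a : ZMod k) (n : ℕ) :
    extZ v (a + 2 * n) = extZ v a := by
  induction n with
  | zero => simp
  | succ n ih =>
    rw [h, ← ih]
    congr 1
    push_cast
    ring

theorem stmt_6 (k : ℕ) (hk : 0 < k) :
    haveI : NeZero k := ⟨hk.ne'⟩
    let A : Matrix (ZMod k) {j : ZMod k // j ≠ 0} (ZMod 2) :=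
      fun i j => (if (j : ZMod k) = i then 1 else 0) +
        (if (j : ZMod k) = i - 2 then 1 else 0)
    (Even k → A.rank = k - 2) ∧ (Odd k → A.rank = k - 1) := by
  haveI : NeZero k := ⟨hk.ne'⟩
  intro A
  have hker : ∀ v, v ∈ LinearMap.ker A.mulVecLin ↔ ∀ i, extZ v i = extZ v (i - 2) := by
    intro v
    rw [LinearMap.mem_ker, Matrix.mulVecLin_apply, funext_iff]
    refine forall_congr' fun i => ?_
    have : (A.mulVec v) i = extZ v i + extZ v (i - 2) := by
      rw [← extZ_sum, ← extZ_sum, ← Finset.sum_add_distrib]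
      simp only [Matrix.mulVec, dotProduct, A, add_mul]
    rw [this, Pi.zero_apply]
    have key : ∀ a b : ZMod 2, a + b = 0 ↔ a = b := by decide
    exact key _ _
  have h0 : ∀ v : {j : ZMod k // j ≠ 0} → ZMod 2, extZ v 0 = 0 := by intro v; simp [extZ]
  have hv : ∀ (v : {j : ZMod k // j ≠ 0} → ZMod 2) j, v j = extZ v j.1 := by
    intro v j; simp [extZ, j.2]
  have hdim := LinearMap.finrank_range_add_finrank_ker A.mulVecLin
  have hc : Module.finrank (ZMod 2) ({j : ZMod k // j ≠ 0} → ZMod 2) = k - 1 := by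
    rw [Module.finrank_fintype_fun_eq_card, Fintype.card_subtype_compl]
    simp [ZMod.card]
  rw [hc] at hdim
  change A.rank + _ = _ at hdim
  constructor
  · intro he
    have h2 : 2 ∣ k := he.two_dvd
    have hk2 : 2 ≤ k := Nat.le_of_dvd hk h2
    haveI : Fact (1 < k) := ⟨hk2⟩
    let f := ZMod.castHom h2 (ZMod 2)
    let w : {j : ZMod k // j ≠ 0} → ZMod 2 := fun j => f j.1
    have hw : ∀ x, extZ w x = f x := by
      intro x
      unfold extZ
      split_ifs with h
      · rfl
      · rw [not_not.1 h, map_zero]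
    have hwk : w ∈ LinearMap.ker A.mulVecLin := by
      rw [hker]
      intro i
      rw [hw, hw, map_sub, map_ofNat]
      generalize f i = a
      revert a
      decide
    have h1 : Module.finrank (ZMod 2) (LinearMap.ker A.mulVecLin) = 1 := by
      rw [finrank_eq_one_iff']
      refine ⟨⟨w, hwk⟩, ?_, ?_⟩
      · intro h
        have h := congrFun (congrArg Subtype.val h) ⟨1, one_ne_zero⟩
        simp [w] at h
      · rintro ⟨v, hvk⟩
        rw [hker] at hvk
        refine ⟨extZ v 1, ?_⟩
        ext1
        funext j
        change extZ v 1 * f j.1 = v j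
        rw [hv v j]
        obtain ⟨n, hn⟩ : ∃ n : ℕ, (n : ZMod k) = j.1 := ⟨_, ZMod.natCast_zmod_val _⟩
        rw [← hn, map_natCast]
        rcases Nat.even_or_odd' n with ⟨m, rfl | rfl⟩
        · have := extZ_even v hvk 0 m
          rw [zero_add, h0] at this
          push_cast
          rw [this, show (2 : ZMod 2) = 0 from rfl]; simp
        · have := extZ_even v hvk 1 m
          push_cast
          rw [add_comm (2 * (m : ZMod k)), this, show (2 : ZMod 2) = 0 from rfl]; simp
    omega
  · intro ho
    have h1 : LinearMap.ker A.mulVecLin = ⊥ := by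
      rw [eq_bot_iff]
      intro v hvk
      rw [hker] at hvk
      rw [Submodule.mem_bot]
      funext j
      rw [hv v j]
      obtain ⟨m, hm⟩ : ∃ m : ℕ, (2 * m : ZMod k) = j.1 := by
        obtain ⟨n, hn⟩ : ∃ n : ℕ, (n : ZMod k) = j.1 := ⟨_, ZMod.natCast_zmod_val _⟩
        rcases Nat.even_or_odd n with h | h
        · obtain ⟨m, rfl⟩ := h.two_dvd
          exact ⟨m, by rw [← hn]; push_cast; rfl⟩
        · obtain ⟨m, hm⟩ := (h.add_odd ho).two_dvd
          refine ⟨m, ?_⟩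
          have := congrArg (Nat.cast : ℕ → ZMod k) hm
          push_cast at this
          rw [← this, ← hn]; simp
      have := extZ_even v hvk 0 m
      rw [zero_add, h0, hm] at this
      simpa using this
    rw [h1, finrank_bot] at hdim
    omega
end

section
/- Let p be a positive natural number. Define the matrix B over the field ZMod 2 with rows indexed by ZMod p and columns indexed by the nonzero elements of ZMod p, whose (i, j) entry is 1 if j = i or j = i − 1 or j = i − 2 (equalities in ZMod p), and 0 otherwise. Then the rank of B equals p − 2 if 3 divides p, and equals p − 1 otherwise. (This is the computation in Section 5: for the knot diagram K on the torus with homotopy class p[m] + 0[l], the incidence matrix with respect to the original region crossing change is B, so rank_{Z_2}(M_K) = p − 2 when 3 | p and p − 1 otherwise; in particular, when p is not a multiple of 3, every crossing point of K is region crossing change admissible.) -/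
/-- the function on `ZMod 3` that vanishes exactly at zero -/
def gThree (a : ZMod 3) : ZMod 2 := if a = 0 then 0 else 1

lemma gThree_sum (a : ZMod 3) : gThree a + gThree (a - 1) + gThree (a - 2) = 0 := by
  revert a; decide

lemma gThree_sum' (a : ZMod 3) : gThree (a + 2) = gThree (a + 1) + gThree a := by
  revert a; decide

lemma zseq (z : ℕ → ZMod 2) (h0 : z 0 = 0) (h : ∀ n, z (n + 2) + z (n + 1) + z n = 0) (n : ℕ) :
    z n = z 1 * gThree (n : ZMod 3) := by
  induction n using Nat.strong_induction_on with
  | _ n ih =>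
    match n with
    | 0 => simp [h0, gThree]
    | 1 => simp [gThree]
    | n + 2 =>
      have h1 := ih n (by omega)
      have h2 := ih (n + 1) (by omega)
      have h3 : z (n + 2) = z (n + 1) + z n := by
        have := h n
        rw [add_assoc, add_eq_zero_iff_eq_neg, CharTwo.neg_eq] at this
        exact this
      rw [h3, h1, h2]
      push_cast
      rw [gThree_sum', mul_add]

/-- the incidence matrix -/
def Bmat (p : ℕ) : Matrix (ZMod p) {j : ZMod p // j ≠ 0} (ZMod 2) :=
  fun i j =>
        if (j : ZMod p) = i ∨ (j : ZMod p) = i - 1 ∨ (j : ZMod p) = i - 2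
        then 1 else 0

/-- extension by zero -/
def ext0 {p : ℕ} (x : {j : ZMod p // j ≠ 0} → ZMod 2) (j : ZMod p) : ZMod 2 :=
  if h : j ≠ 0 then x ⟨j, h⟩ else 0

lemma Bmat_mulVec (p : ℕ) [NeZero p] (hp : 3 ≤ p) (x : {j : ZMod p // j ≠ 0} → ZMod 2)
    (i : ZMod p) :
    (Bmat p).mulVec x i = ext0 x i + ext0 x (i - 1) + ext0 x (i - 2) := by
  have hone : (1 : ZMod p) ≠ 0 := by
    intro h
    have : ((1 : ℕ) : ZMod p) = 0 := by exact_mod_cast h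
    rw [ZMod.natCast_eq_zero_iff] at this
    have := Nat.le_of_dvd (by norm_num) this
    omega
  have htwo : (2 : ZMod p) ≠ 0 := by
    intro h
    have : ((2 : ℕ) : ZMod p) = 0 := by exact_mod_cast h
    rw [ZMod.natCast_eq_zero_iff] at this
    have := Nat.le_of_dvd (by norm_num) this
    omega
  have d1 : i ≠ i - 1 := by intro h; apply hone; linear_combination h
  have d2 : i ≠ i - 2 := by intro h; apply htwo; linear_combination h
  have d3 : i - 1 ≠ i - 2 := by intro h; apply hone; linear_combination h
  have e1 : (Bmat p).mulVec x i
      = ∑ j : {j : ZMod p // j ≠ 0}, if (j : ZMod p) ∈ ({i, i - 1, i - 2} : Finset (ZMod p))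
          then ext0 x j else 0 := by
    unfold Matrix.mulVec dotProduct
    refine Finset.sum_congr rfl fun j _ => ?_
    have : ext0 x j = x j := by simp [ext0, j.2]
    simp [Bmat, this]
  have e2 : (∑ j : {j : ZMod p // j ≠ 0}, if (j : ZMod p) ∈ ({i, i - 1, i - 2} : Finset (ZMod p))
          then ext0 x j else 0) = ∑ j : ZMod p, if j ∈ ({i, i - 1, i - 2} : Finset (ZMod p))
          then ext0 x j else 0 := by
    have hs := Finset.sum_subtype (F := inferInstance) (p := fun j : ZMod p => j ≠ 0)
      (Finset.univ.filter (fun j : ZMod p => j ≠ 0)) (by simp)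
      (fun j => if j ∈ ({i, i - 1, i - 2} : Finset (ZMod p)) then ext0 x j else 0)
    refine hs.symm.trans ?_
    apply Finset.sum_subset (Finset.filter_subset _ _)
    intro j _ hj
    have hj0 : j = 0 := by simpa using hj
    simp [hj0, ext0]
  rw [e1, e2, Finset.sum_ite_mem, Finset.univ_inter, Finset.sum_insert, Finset.sum_insert,
    Finset.sum_singleton, add_assoc]
  · simpa using d3
  · simp only [Finset.mem_insert, Finset.mem_singleton, not_or]; exact ⟨d1, d2⟩

lemma ker_form (p : ℕ) [NeZero p] (hp : 3 ≤ p) (x : {j : ZMod p // j ≠ 0} → ZMod 2)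
    (hx : (Bmat p).mulVec x = 0) (n : ℕ) :
    ext0 x (n : ZMod p) = ext0 x 1 * gThree (n : ZMod 3) := by
  have := zseq (fun n => ext0 x (n : ZMod p)) (by simp [ext0]) (by
    intro n
    have h := congrFun hx ((n + 2 : ℕ) : ZMod p)
    rw [Bmat_mulVec p hp] at h
    have a1 : ((n + 2 : ℕ) : ZMod p) - 1 = ((n + 1 : ℕ) : ZMod p) := by push_cast; ring
    have a2 : ((n + 2 : ℕ) : ZMod p) - 2 = (n : ZMod p) := by push_cast; ring
    rw [a1, a2] at h
    exact h) n
  simpa using this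

lemma rank_add (p : ℕ) [NeZero p] :
    (Bmat p).rank + Module.finrank (ZMod 2) (LinearMap.ker (Bmat p).mulVecLin) = p - 1 := by
  have h := LinearMap.finrank_range_add_finrank_ker (Bmat p).mulVecLin
  rw [Module.finrank_fintype_fun_eq_card] at h
  rw [Matrix.rank, h]
  simp [Fintype.card_subtype_compl, ZMod.card]

lemma two_case : ∀ x : {j : ZMod 2 // j ≠ 0} → ZMod 2, (Bmat 2).mulVec x = 0 → x = 0 := by
  decide

lemma ker_bot (p : ℕ) [NeZero p] (h3 : ¬ 3 ∣ p) : LinearMap.ker (Bmat p).mulVecLin = ⊥ := by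
  rw [LinearMap.ker_eq_bot']
  intro x hx
  rw [Matrix.mulVecLin_apply] at hx
  rcases lt_or_ge p 3 with hp | hp
  · have : p ≠ 0 := NeZero.ne p
    have : p = 1 ∨ p = 2 := by omega
    rcases this with rfl | rfl
    · ext j
      exact absurd (Subsingleton.elim _ _) j.2
    · exact two_case x hx
  · have hz := ker_form p hp x hx p
    have hg : gThree (p : ZMod 3) = 1 := by
      unfold gThree
      rw [if_neg]
      rwa [ZMod.natCast_eq_zero_iff]
    rw [hg, mul_one] at hz
    have h1 : ext0 x 1 = 0 := by rw [← hz]; simp [ext0]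
    ext j
    have := ker_form p hp x hx (j : ZMod p).val
    rw [h1, zero_mul, ZMod.natCast_zmod_val] at this
    simpa [ext0, j.2] using this

lemma ker_one (p : ℕ) [NeZero p] (h3 : 3 ∣ p) :
    Module.finrank (ZMod 2) (LinearMap.ker (Bmat p).mulVecLin) = 1 := by
  have hp : 3 ≤ p := Nat.le_of_dvd (NeZero.pos p) h3
  let c : ZMod p →+* ZMod 3 := ZMod.castHom h3 (ZMod 3)
  let v : {j : ZMod p // j ≠ 0} → ZMod 2 := fun j => gThree (c j)
  have hv : ∀ j, ext0 v j = gThree (c j) := by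
    intro j
    by_cases h : j = 0
    · subst h; simp [ext0, gThree]
    · simp [ext0, h, v]
  have hker : LinearMap.ker (Bmat p).mulVecLin = Submodule.span (ZMod 2) {v} := by
    ext x
    rw [Submodule.mem_span_singleton, LinearMap.mem_ker, Matrix.mulVecLin_apply]
    constructor
    · intro hx
      refine ⟨ext0 x 1, ?_⟩
      ext j
      have := ker_form p hp x hx (j : ZMod p).val
      rw [← map_natCast c, ZMod.natCast_zmod_val] at this
      simp only [Pi.smul_apply, smul_eq_mul, v]
      rw [← this]
      simp [ext0, j.2]
    · rintro ⟨a, rfl⟩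
      rw [Matrix.mulVec_smul]
      have : (Bmat p).mulVec v = 0 := by
        ext i
        rw [Bmat_mulVec p hp, hv, hv, hv, map_sub, map_sub, map_one, map_ofNat, gThree_sum]
        rfl
      rw [this, smul_zero]
  rw [hker, finrank_span_singleton]
  intro h
  have := hv 1
  rw [h, map_one] at this
  simp [ext0, gThree] at this

theorem stmt_7 (p : ℕ) (hp : 0 < p) :
    haveI : NeZero p := ⟨hp.ne'⟩
    let B : Matrix (ZMod p) {j : ZMod p // j ≠ 0} (ZMod 2) :=
      fun i j =>
        if (j : ZMod p) = i ∨ (j : ZMod p) = i - 1 ∨ (j : ZMod p) = i - 2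
        then 1 else 0
    (3 ∣ p → B.rank = p - 2) ∧ (¬ 3 ∣ p → B.rank = p - 1) := by
  haveI : NeZero p := ⟨hp.ne'⟩
  have h := rank_add p
  refine ⟨fun h3 => ?_, fun h3 => ?_⟩
  · change (Bmat p).rank = p - 2
    rw [ker_one p h3] at h
    omega
  · change (Bmat p).rank = p - 1
    rw [ker_bot p h3, finrank_bot] at h
    omega
end
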